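/- arXiv:2303.11495 — 2 statements merged into one kernel-verified Lean document; each statement's English description precedes it below -/
import Mathlib

section
/- Suppose U > 0 and h, u solve the linearized Serre equations on [x_L, x_R] × [0, ∞). Let α₂, α₃, α₄, β₂, β₃, β₄ be real numbers, and let R be the symmetric 3×3 real matrix with rows [λ₂+β₂²λ₅, β₂β₃λ₅, β₂β₄λ₅], [β₂β₃λ₅, λ₃+β₃²λ₅, β₃β₄λ₅], [β₂β₄λ₅, β₃β₄λ₅, λ₄+β₄²λ₅]. Assume vᵀR v ≤ 0 for all v ∈ ℝ³, that λ₂α₂² + λ₃α₃² + λ₄α₄² + λ₅ ≥ 0, and that for all t ≥ 0 the boundary conditions w_j(x_L,t) = α_j·w₅(x_L,t) for j = 2, 3, 4 and w₅(x_R,t) = β₂·w₂(x_R,t) + β₃·w₃(x_R,t) + β₄·w₄(x_R,t) hold. Then the energy is bounded by the energy of the initial data: E(t) ≤ E(0) for all t ≥ 0. -/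
open Real MeasureTheory Set

noncomputable section

/-- Partial derivative in the spatial variable `x` (first argument). -/
def pdX (f : ℝ → ℝ → ℝ) (x t : ℝ) : ℝ := deriv (fun ξ => f ξ t) x

/-- Partial derivative in the temporal variable `t` (second argument). -/
def pdT (f : ℝ → ℝ → ℝ) (x t : ℝ) : ℝ := deriv (fun τ => f x τ) t

/-- `h, u` solve the linearized Serre equations on `[xL, xR] × [0, ∞)`:
they are sufficiently smooth and satisfy the continuity and momentum equations. -/
def SolvesSerre (g H U xL xR : ℝ) (h u : ℝ → ℝ → ℝ) : Prop :=
  ContDiff ℝ 3 (fun p : ℝ × ℝ => h p.1 p.2) ∧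
  ContDiff ℝ 3 (fun p : ℝ × ℝ => u p.1 p.2) ∧
  (∀ x ∈ Set.Icc xL xR, ∀ t : ℝ, 0 ≤ t →
    pdT h x t + pdX (fun ξ τ => H * u ξ τ + U * h ξ τ) x t = 0) ∧
  (∀ x ∈ Set.Icc xL xR, ∀ t : ℝ, 0 ≤ t →
    pdT u x t + pdX (fun ξ τ => g * h ξ τ + U * u ξ τ
      - H ^ 2 * U / 3 * pdX (pdX u) ξ τ
      - H ^ 2 / 3 * pdT (pdX u) ξ τ) x t = 0)

/-- The energy `E(t)` on the interval `[xL, xR]`. -/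
def energy (g H xL xR : ℝ) (h u : ℝ → ℝ → ℝ) (t : ℝ) : ℝ :=
  g / 2 * (∫ x in xL..xR, h x t ^ 2)
    + H / 2 * (∫ x in xL..xR, u x t ^ 2)
    + H ^ 3 / 6 * (∫ x in xL..xR, pdX u x t ^ 2)

/-- The boundary term `BT(h, u)(x, t)`. -/
def BT (g H U : ℝ) (h u : ℝ → ℝ → ℝ) (x t : ℝ) : ℝ :=
  -(g * H) * h x t * u x t - g * U / 2 * h x t ^ 2 - H * U / 2 * u x t ^ 2
    - H ^ 3 * U / 6 * pdX u x t ^ 2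
    + H ^ 3 * U / 3 * (u x t * pdX (pdX u) x t)
    + H ^ 3 / 3 * (u x t * pdT (pdX u) x t)

def sconst (H U : ℝ) : ℝ := Real.sqrt (4 * H ^ 4 + 9 * U ^ 2)
def Cplus (H U : ℝ) : ℝ := Real.sqrt (4 * H ^ 4 + (3 * U + sconst H U) ^ 2)
def Cminus (H U : ℝ) : ℝ := Real.sqrt (4 * H ^ 4 + (3 * U - sconst H U) ^ 2)
def lam2 (H U : ℝ) : ℝ := -(H ^ 3 * U) / 6
def lam3 (g U : ℝ) : ℝ := -(g * U) / 2
def lam4 (H U : ℝ) : ℝ := -(H * U) / 4 - H * sconst H U / 12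
def lam5 (H U : ℝ) : ℝ := -(H * U) / 4 + H * sconst H U / 12

/-- Characteristic variable `w₂ = ∂u/∂x`. -/
def wv2 (u : ℝ → ℝ → ℝ) (x t : ℝ) : ℝ := pdX u x t

/-- Characteristic variable `w₃ = h`. -/
def wv3 (h : ℝ → ℝ → ℝ) (x t : ℝ) : ℝ := h x t

/-- Characteristic variable `w₄`. -/
def wv4 (g H U : ℝ) (h u : ℝ → ℝ → ℝ) (x t : ℝ) : ℝ :=
  1 / Cplus H U * (2 * H ^ 2 * U * pdX (pdX u) x t + 2 * H ^ 2 * pdT (pdX u) x t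
    - 6 * g * h x t - (3 * U + sconst H U) * u x t)

/-- Characteristic variable `w₅`. -/
def wv5 (g H U : ℝ) (h u : ℝ → ℝ → ℝ) (x t : ℝ) : ℝ :=
  1 / Cminus H U * (2 * H ^ 2 * U * pdX (pdX u) x t + 2 * H ^ 2 * pdT (pdX u) x t
    - 6 * g * h x t - (3 * U - sconst H U) * u x t)

lemma hasDerivAt_fst_pdX {f : ℝ → ℝ → ℝ}
    (hf : Differentiable ℝ (fun p : ℝ × ℝ => f p.1 p.2)) (x t : ℝ) :
    HasDerivAt (fun ξ => f ξ t) (pdX f x t) x := by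
  have : DifferentiableAt ℝ (fun ξ => f ξ t) x :=
    (hf (x, t)).comp x (f := fun ξ : ℝ => (ξ, t)) (by fun_prop)
  exact this.hasDerivAt

lemma hasDerivAt_snd_pdT {f : ℝ → ℝ → ℝ}
    (hf : Differentiable ℝ (fun p : ℝ × ℝ => f p.1 p.2)) (x t : ℝ) :
    HasDerivAt (fun τ => f x τ) (pdT f x t) t := by
  have : DifferentiableAt ℝ (fun τ => f x τ) t :=
    (hf (x, t)).comp t (f := fun τ : ℝ => (x, τ)) (by fun_prop)
  exact this.hasDerivAt

lemma contDiff_pdX {f : ℝ → ℝ → ℝ} {n m : ℕ} (hnm : m + 1 ≤ n)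
    (hf : ContDiff ℝ n (fun p : ℝ × ℝ => f p.1 p.2)) :
    ContDiff ℝ m (fun p : ℝ × ℝ => pdX f p.1 p.2) := by
  have hd : Differentiable ℝ (fun p : ℝ × ℝ => f p.1 p.2) :=
    hf.differentiable (by norm_cast; lia)
  have heq : (fun p : ℝ × ℝ => pdX f p.1 p.2)
      = fun p => fderiv ℝ (fun p : ℝ × ℝ => f p.1 p.2) p (1, 0) := by
    funext p
    exact ((hd p).hasFDerivAt.comp_hasDerivAt p.1
      ((hasDerivAt_id p.1).prodMk (hasDerivAt_const p.1 p.2))).deriv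
  rw [heq]
  exact (hf.fderiv_right (by exact_mod_cast hnm)).clm_apply contDiff_const

lemma contDiff_pdT {f : ℝ → ℝ → ℝ} {n m : ℕ} (hnm : m + 1 ≤ n)
    (hf : ContDiff ℝ n (fun p : ℝ × ℝ => f p.1 p.2)) :
    ContDiff ℝ m (fun p : ℝ × ℝ => pdT f p.1 p.2) := by
  have hd : Differentiable ℝ (fun p : ℝ × ℝ => f p.1 p.2) :=
    hf.differentiable (by norm_cast; lia)
  have heq : (fun p : ℝ × ℝ => pdT f p.1 p.2)
      = fun p => fderiv ℝ (fun p : ℝ × ℝ => f p.1 p.2) p (0, 1) := by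
    funext p
    exact ((hd p).hasFDerivAt.comp_hasDerivAt p.2
      ((hasDerivAt_const p.2 p.1).prodMk (hasDerivAt_id p.2))).deriv
  rw [heq]
  exact (hf.fderiv_right (by exact_mod_cast hnm)).clm_apply contDiff_const

/-- Differentiation under the integral sign on a compact interval. -/
lemma hasDerivAt_intervalIntegral_pdT {f : ℝ → ℝ → ℝ}
    (hf : ContDiff ℝ 1 (fun p : ℝ × ℝ => f p.1 p.2)) (a b t : ℝ) :
    HasDerivAt (fun τ => ∫ x in a..b, f x τ) (∫ x in a..b, pdT f x t) t := by
  have hc : Continuous (fun p : ℝ × ℝ => pdT f p.1 p.2) :=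
    (contDiff_pdT (n := 1) (m := 0) le_rfl (by exact_mod_cast hf)).continuous
  have hslice : ∀ τ, Continuous (fun x => f x τ) := fun τ =>
    hf.continuous.comp (f := fun x : ℝ => (x, τ)) (by fun_prop)
  have hslice' : Continuous (fun x => pdT f x t) :=
    hc.comp (f := fun x : ℝ => (x, t)) (by fun_prop)
  obtain ⟨C, hC⟩ := (isCompact_uIcc (a := a) (b := b)).prod
    (isCompact_closedBall t 1) |>.exists_bound_of_continuousOn hc.continuousOn
  refine (intervalIntegral.hasDerivAt_integral_of_dominated_loc_of_deriv_le
    (F := fun τ x => f x τ) (F' := fun τ x => pdT f x τ) (bound := fun _ => C)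
    (Metric.closedBall_mem_nhds t one_pos)
    (Filter.Eventually.of_forall fun τ => (hslice τ).aestronglyMeasurable)
    ((hslice t).intervalIntegrable a b) hslice'.aestronglyMeasurable
    (Filter.Eventually.of_forall fun x hx τ hτ => hC (x, τ) ⟨uIoc_subset_uIcc hx, hτ⟩)
    intervalIntegrable_const
    (Filter.Eventually.of_forall fun x _ τ _ =>
      hasDerivAt_snd_pdT (hf.differentiable one_ne_zero) x τ)).2

lemma hasDerivAt_intervalIntegral_sq {f : ℝ → ℝ → ℝ}
    (hf : ContDiff ℝ 1 (fun p : ℝ × ℝ => f p.1 p.2)) (a b t : ℝ) :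
    HasDerivAt (fun τ => ∫ x in a..b, f x τ ^ 2)
      (∫ x in a..b, 2 * f x t * pdT f x t) t := by
  have hsq := hasDerivAt_intervalIntegral_pdT (f := fun x τ => f x τ ^ 2) (hf.pow 2) a b t
  have heq : ∀ x, pdT (fun x τ => f x τ ^ 2) x t = 2 * f x t * pdT f x t := fun x => by
    refine ((hasDerivAt_snd_pdT (hf.differentiable one_ne_zero) x t).fun_pow 2).deriv.trans ?_
    simp
  simpa only [heq] using hsq

lemma hasDerivAt_energy {g H U xL xR : ℝ} {h u : ℝ → ℝ → ℝ} (hx : xL ≤ xR)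
    (hsol : SolvesSerre g H U xL xR h u) {t : ℝ} (ht : 0 ≤ t) :
    HasDerivAt (energy g H xL xR h u) (BT g H U h u xR t - BT g H U h u xL t) t := by
  obtain ⟨ch, cu, pde₁, pde₂⟩ := hsol
  have cux : ContDiff ℝ (2 : ℕ) (fun p : ℝ × ℝ => pdX u p.1 p.2) :=
    contDiff_pdX (n := 3) le_rfl (by exact_mod_cast cu)
  have cuxx : ContDiff ℝ (1 : ℕ) (fun p : ℝ × ℝ => pdX (pdX u) p.1 p.2) :=
    contDiff_pdX le_rfl cux
  have cuxt : ContDiff ℝ (1 : ℕ) (fun p : ℝ × ℝ => pdT (pdX u) p.1 p.2) :=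
    contDiff_pdT le_rfl cux
  have cht : ContDiff ℝ (2 : ℕ) (fun p : ℝ × ℝ => pdT h p.1 p.2) :=
    contDiff_pdT (n := 3) le_rfl (by exact_mod_cast ch)
  have cut : ContDiff ℝ (2 : ℕ) (fun p : ℝ × ℝ => pdT u p.1 p.2) :=
    contDiff_pdT (n := 3) le_rfl (by exact_mod_cast cu)
  have slice : ∀ {f : ℝ → ℝ → ℝ}, Continuous (fun p : ℝ × ℝ => f p.1 p.2) →
      Continuous (fun x => f x t) := fun hf =>
    hf.comp (f := fun x : ℝ => (x, t)) (by fun_prop)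
  have sh := slice ch.continuous
  have su := slice cu.continuous
  have sux := slice cux.continuous
  have suxt := slice cuxt.continuous
  have sht := slice cht.continuous
  have sut := slice cut.continuous
  have hE := (((hasDerivAt_intervalIntegral_sq (ch.of_le (by norm_num)) xL xR t).const_mul
    (g / 2)).add ((hasDerivAt_intervalIntegral_sq (cu.of_le (by norm_num)) xL xR t).const_mul
    (H / 2))).add ((hasDerivAt_intervalIntegral_sq (cux.of_le (by norm_num)) xL xR t).const_mul
    (H ^ 3 / 6))
  refine hE.congr_deriv ?_
  simp only [← intervalIntegral.integral_const_mul]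
  rw [← intervalIntegral.integral_add (Continuous.intervalIntegrable (by fun_prop) _ _)
      (Continuous.intervalIntegrable (by fun_prop) _ _),
    ← intervalIntegral.integral_add (Continuous.intervalIntegrable (by fun_prop) _ _)
      (Continuous.intervalIntegrable (by fun_prop) _ _)]
  refine intervalIntegral.integral_eq_sub_of_hasDerivAt (f := fun x => BT g H U h u x t)
    (fun x hmem => ?_) (Continuous.intervalIntegrable (by fun_prop) _ _)
  rw [uIcc_of_le hx] at hmem
  have dh := hasDerivAt_fst_pdX (ch.differentiable (by norm_num)) x t
  have du := hasDerivAt_fst_pdX (cu.differentiable (by norm_num)) x t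
  have dux := hasDerivAt_fst_pdX (cux.differentiable (by norm_num)) x t
  have duxx := hasDerivAt_fst_pdX (cuxx.differentiable (by norm_num)) x t
  have duxt := hasDerivAt_fst_pdX (cuxt.differentiable (by norm_num)) x t
  have flux₁ : pdX (fun ξ τ => H * u ξ τ + U * h ξ τ) x t
      = H * pdX u x t + U * pdX h x t :=
    ((du.const_mul H).add (dh.const_mul U)).deriv
  have flux₂ : pdX (fun ξ τ => g * h ξ τ + U * u ξ τ
      - H ^ 2 * U / 3 * pdX (pdX u) ξ τ - H ^ 2 / 3 * pdT (pdX u) ξ τ) x t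
      = g * pdX h x t + U * pdX u x t - H ^ 2 * U / 3 * pdX (pdX (pdX u)) x t
        - H ^ 2 / 3 * pdX (pdT (pdX u)) x t :=
    ((((dh.const_mul g).add (du.const_mul U)).sub (duxx.const_mul (H ^ 2 * U / 3))).sub
      (duxt.const_mul (H ^ 2 / 3))).deriv
  have e₁ := pde₁ x hmem t ht
  have e₂ := pde₂ x hmem t ht
  rw [flux₁] at e₁
  rw [flux₂] at e₂
  have dBT := (((((dh.const_mul (-(g * H))).mul du).sub ((dh.pow 2).const_mul (g * U / 2))).sub
    ((du.pow 2).const_mul (H * U / 2))).sub ((dux.pow 2).const_mul (H ^ 3 * U / 6))).add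
    ((du.mul duxx).const_mul (H ^ 3 * U / 3)) |>.add ((du.mul duxt).const_mul (H ^ 3 / 3))
  refine dBT.congr_deriv ?_
  push_cast
  linear_combination (-(g * h x t)) * e₁ - H * u x t * e₂

/-- Diagonalization of the boundary term in the characteristic variables. -/
lemma BT_eq_characteristic {g H U : ℝ} (hH : 0 < H) (h u : ℝ → ℝ → ℝ) (x t : ℝ) :
    BT g H U h u x t = lam2 H U * wv2 u x t ^ 2 + lam3 g U * wv3 h x t ^ 2
      + lam4 H U * wv4 g H U h u x t ^ 2 + lam5 H U * wv5 g H U h u x t ^ 2 := by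
  have hH4 : 0 < H ^ 4 := by positivity
  have hs2 : sconst H U ^ 2 = 4 * H ^ 4 + 9 * U ^ 2 := Real.sq_sqrt (by positivity)
  have hs : 0 < sconst H U := Real.sqrt_pos.mpr (by positivity)
  have hlt : |3 * U| < sconst H U := abs_lt_of_sq_lt_sq (by nlinarith) hs.le
  obtain ⟨hneg, hpos⟩ := abs_lt.mp hlt
  have hp2 : Cplus H U ^ 2 = 2 * sconst H U * (sconst H U + 3 * U) := by
    rw [Cplus, Real.sq_sqrt (by positivity)]; linear_combination -hs2
  have hm2 : Cminus H U ^ 2 = 2 * sconst H U * (sconst H U - 3 * U) := by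
    rw [Cminus, Real.sq_sqrt (by positivity)]; linear_combination -hs2
  have hp : 0 < sconst H U + 3 * U := by linarith
  have hm : 0 < sconst H U - 3 * U := by linarith
  have hs0 := hs.ne'
  have h4 : lam4 H U * (1 / Cplus H U) ^ 2 = -H / (24 * sconst H U) := by
    rw [div_pow, hp2, one_pow, mul_one_div, div_eq_div_iff (by positivity) (by positivity), lam4]
    ring
  have h5 : lam5 H U * (1 / Cminus H U) ^ 2 = H / (24 * sconst H U) := by
    rw [div_pow, hm2, one_pow, mul_one_div, div_eq_div_iff (by positivity) (by positivity), lam5]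
    ring
  rw [wv4, wv5, mul_pow, mul_pow, ← mul_assoc, ← mul_assoc, h4, h5]
  simp only [BT, lam2, lam3, wv2, wv3]
  field_simp
  ring

open Matrix in
/-- Theorem 3.7: well-posedness of the IBVP for `U > 0`; the energy is bounded
by the energy of the initial data. -/
theorem energy_bound_ibvp_U_pos (g H U xL xR : ℝ) (hg : 0 < g) (hH : 0 < H)
    (hx : xL < xR) (hU : 0 < U) (h u : ℝ → ℝ → ℝ)
    (hsol : SolvesSerre g H U xL xR h u) (α₂ α₃ α₄ β₂ β₃ β₄ : ℝ)
    (hR : ∀ v : Fin 3 → ℝ,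
      v ⬝ᵥ ((!![lam2 H U + β₂ ^ 2 * lam5 H U, β₂ * β₃ * lam5 H U, β₂ * β₄ * lam5 H U;
              β₂ * β₃ * lam5 H U, lam3 g U + β₃ ^ 2 * lam5 H U, β₃ * β₄ * lam5 H U;
              β₂ * β₄ * lam5 H U, β₃ * β₄ * lam5 H U, lam4 H U + β₄ ^ 2 * lam5 H U]) *ᵥ v)
        ≤ 0)
    (hα : lam2 H U * α₂ ^ 2 + lam3 g U * α₃ ^ 2 + lam4 H U * α₄ ^ 2 + lam5 H U ≥ 0)
    (hbcL2 : ∀ t : ℝ, 0 ≤ t → wv2 u xL t = α₂ * wv5 g H U h u xL t)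
    (hbcL3 : ∀ t : ℝ, 0 ≤ t → wv3 h xL t = α₃ * wv5 g H U h u xL t)
    (hbcL4 : ∀ t : ℝ, 0 ≤ t → wv4 g H U h u xL t = α₄ * wv5 g H U h u xL t)
    (hbcR : ∀ t : ℝ, 0 ≤ t → wv5 g H U h u xR t
      = β₂ * wv2 u xR t + β₃ * wv3 h xR t + β₄ * wv4 g H U h u xR t) :
    ∀ t : ℝ, 0 ≤ t → energy g H xL xR h u t ≤ energy g H xL xR h u 0 := by
  have hderiv := fun t ht => hasDerivAt_energy hx.le hsol (t := t) ht
  have hBTR : ∀ t, 0 ≤ t → BT g H U h u xR t ≤ 0 := fun t ht => by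
    have hq := hR ![wv2 u xR t, wv3 h xR t, wv4 g H U h u xR t]
    rw [BT_eq_characteristic hH, hbcR t ht]
    simp only [dotProduct, Matrix.mulVec, Fin.sum_univ_three, Matrix.of_apply,
      Matrix.cons_val] at hq
    linarith
  have hBTL : ∀ t, 0 ≤ t → 0 ≤ BT g H U h u xL t := fun t ht => by
    rw [BT_eq_characteristic hH, hbcL2 t ht, hbcL3 t ht, hbcL4 t ht]
    linarith [mul_nonneg hα.le (sq_nonneg (wv5 g H U h u xL t))]
  have hanti : AntitoneOn (energy g H xL xR h u) (Ici 0) := by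
    refine antitoneOn_of_deriv_nonpos (convex_Ici 0)
      (fun t ht => (hderiv t ht).continuousAt.continuousWithinAt) (fun t ht => ?_)
      (fun t ht => ?_)
    all_goals have ht' := interior_subset ht
    · exact (hderiv t ht').differentiableAt.differentiableWithinAt
    · rw [(hderiv t ht').deriv]
      linarith [hBTR t ht', hBTL t ht']
  exact fun t ht => hanti self_mem_Ici ht ht
end
end

section
/- Let g, H > 0 and U ∈ ℝ, and set s = √(4H⁴ + 9U²), C⁺ = √(4H⁴ + (3U + s)²), C⁻ = √(4H⁴ + (3U − s)²), λ₂ = −H³U/6, λ₃ = −gU/2, λ₄ = −HU/4 − H·s/12, λ₅ = −HU/4 + H·s/12. Then for all real numbers h, u, p, q, r, defining w₄ = (1/C⁺)(2H²U·q + 2H²·r − 6g·h − (3U + s)·u) and w₅ = (1/C⁻)(2H²U·q + 2H²·r − 6g·h − (3U − s)·u), the following identity holds: −gH·h·u − (gU/2)·h² − (HU/2)·u² − (H³U/6)·p² + (H³U/3)·u·q + (H³/3)·u·r = λ₂·p² + λ₃·h² + λ₄·w₄² + λ₅·w₅². -/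
noncomputable section

theorem sconst_sq (H U : ℝ) : sconst H U ^ 2 = 4 * H ^ 4 + 9 * U ^ 2 :=
  Real.sq_sqrt (by positivity)

theorem abs_three_mul_lt_sconst {H : ℝ} (hH : 0 < H) (U : ℝ) : |3 * U| < sconst H U := by
  refine abs_lt_of_sq_lt_sq ?_ (Real.sqrt_nonneg _)
  rw [sconst_sq]
  have : 0 < H ^ 4 := by positivity
  linarith [mul_pow 3 U 2]

theorem sconst_pos {H : ℝ} (hH : 0 < H) (U : ℝ) : 0 < sconst H U :=
  (abs_nonneg _).trans_lt (abs_three_mul_lt_sconst hH U)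

theorem Cplus_sq (H U : ℝ) : Cplus H U ^ 2 = 2 * sconst H U * (sconst H U + 3 * U) := by
  rw [Cplus, Real.sq_sqrt (by positivity)]
  linear_combination -sconst_sq H U

theorem Cminus_sq (H U : ℝ) : Cminus H U ^ 2 = 2 * sconst H U * (sconst H U - 3 * U) := by
  rw [Cminus, Real.sq_sqrt (by positivity)]
  linear_combination -sconst_sq H U

theorem lam4_mul_sq {H : ℝ} (hH : 0 < H) (U x : ℝ) :
    lam4 H U * (1 / Cplus H U * x) ^ 2 = -(H / (24 * sconst H U)) * x ^ 2 := by
  have hs := abs_lt.mp (abs_three_mul_lt_sconst hH U)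
  have hs_ne : sconst H U ≠ 0 := (sconst_pos hH U).ne'
  have hd : sconst H U + 3 * U ≠ 0 := ne_of_gt (by linarith)
  have hl : lam4 H U = -(H / 12) * (sconst H U + 3 * U) := by
    rw [lam4]
    ring
  rw [mul_pow, div_pow, Cplus_sq, hl]
  generalize sconst H U + 3 * U = d at hd
  field_simp
  ring

theorem lam5_mul_sq {H : ℝ} (hH : 0 < H) (U x : ℝ) :
    lam5 H U * (1 / Cminus H U * x) ^ 2 = H / (24 * sconst H U) * x ^ 2 := by
  have hs := abs_lt.mp (abs_three_mul_lt_sconst hH U)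
  have hs_ne : sconst H U ≠ 0 := (sconst_pos hH U).ne'
  have hd : sconst H U - 3 * U ≠ 0 := ne_of_gt (by linarith)
  have hl : lam5 H U = H / 12 * (sconst H U - 3 * U) := by
    rw [lam5]
    ring
  rw [mul_pow, div_pow, Cminus_sq, hl]
  generalize sconst H U - 3 * U = d at hd
  field_simp
  ring

/-- Diagonalization of the boundary term of the linearized Serre equations:
`BT = λ₂ p² + λ₃ h² + λ₄ w₄² + λ₅ w₅²` where `p = ∂u/∂x`, `q = ∂²u/∂x²`,
`r = ∂²u/(∂x∂t)`. -/
theorem boundary_term_diagonalization (g H U : ℝ) (hg : 0 < g) (hH : 0 < H)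
    (h u p q r : ℝ) :
    -(g * H) * h * u - g * U / 2 * h ^ 2 - H * U / 2 * u ^ 2
        - H ^ 3 * U / 6 * p ^ 2 + H ^ 3 * U / 3 * (u * q) + H ^ 3 / 3 * (u * r)
      = lam2 H U * p ^ 2 + lam3 g U * h ^ 2
        + lam4 H U * (1 / Cplus H U
            * (2 * H ^ 2 * U * q + 2 * H ^ 2 * r - 6 * g * h
              - (3 * U + sconst H U) * u)) ^ 2
        + lam5 H U * (1 / Cminus H U
            * (2 * H ^ 2 * U * q + 2 * H ^ 2 * r - 6 * g * h
              - (3 * U - sconst H U) * u)) ^ 2 := by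
  have hs : sconst H U ≠ 0 := (sconst_pos hH U).ne'
  rw [lam4_mul_sq hH, lam5_mul_sq hH, lam2, lam3]
  field_simp
  ring
end
end
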